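/- Let H1 and H2 be real Hilbert spaces, let U be a subset of H1, and let ω : (0,∞) → [0,∞) be a nonnegative concave function with lim_{t→0+} ω(t) = 0. If G : U → H2 satisfies ‖G(x) − G(y)‖_{H2} ≤ ω(‖x − y‖_{H1}) for all x, y ∈ U with x ≠ y, then there exists a map 𝖦 : H1 → H2 defined on all of H1 such that 𝖦(x) = G(x) for every x ∈ U and ‖𝖦(x) − 𝖦(y)‖_{H2} ≤ ω(‖x − y‖_{H1}) for all x, y ∈ H1 with x ≠ y. -/

import Mathlib

open Filter

/-- A supergradient of `ω ^ 2` as a function of the square of the variable. -/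
lemma bl_supergrad (ω : ℝ → ℝ) (hn : ∀ t > (0 : ℝ), 0 ≤ ω t)
    (hc : ConcaveOn ℝ (Set.Ioi 0) ω) (r : ℝ) (hr : 0 < r) :
    ∃ D : ℝ, 0 ≤ D ∧ D * r ^ 2 ≤ ω r ^ 2 ∧
      ∀ t > 0, ω t ^ 2 ≤ ω r ^ 2 + D * (t ^ 2 - r ^ 2) := by
  obtain ⟨k, hk1, hk2⟩ := exists_between_of_forall_le
    (s := (fun t => (ω t - ω r) / (t - r)) '' Set.Ioi r)
    (t := (fun t => (ω r - ω t) / (r - t)) '' Set.Ioo 0 r)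
    ⟨_, r + 1, by simp, rfl⟩ ⟨_, r / 2, ⟨by positivity, by linarith⟩, rfl⟩ (by
      rintro _ ⟨a, ha, rfl⟩ _ ⟨b, hb, rfl⟩
      have ha' : r < a := ha
      exact hc.slope_anti_adjacent (show b ∈ Set.Ioi 0 from hb.1)
        (show a ∈ Set.Ioi 0 from hr.trans ha') hb.2 ha')
  have hk : ∀ t > 0, ω t ≤ ω r + k * (t - r) := by
    intro t ht
    rcases lt_trichotomy t r with h | h | h
    · have := hk2 ⟨t, ⟨ht, h⟩, rfl⟩
      have h2 : 0 < r - t := by linarith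
      simp only at this
      rw [le_div_iff₀ h2] at this
      linarith
    · subst h; simp
    · have := hk1 ⟨t, h, rfl⟩
      have h2 : 0 < t - r := by linarith
      simp only at this
      rw [div_le_iff₀ h2] at this
      linarith
  have hwr := hn r hr
  have hk0 : 0 ≤ k := by
    by_contra h
    push Not at h
    have hp : 0 < (ω r + 1) / (-k) := div_pos (by linarith) (by linarith)
    have h1 := hk (r + (ω r + 1) / (-k)) (by linarith)
    have h2 := hn (r + (ω r + 1) / (-k)) (by linarith)
    have h3 : k * (r + (ω r + 1) / (-k) - r) = - (ω r + 1) := by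
      have : k ≠ 0 := h.ne
      field_simp
      ring
    linarith
  have hkr : k * r ≤ ω r := by
    by_contra h
    push Not at h
    have hkp : 0 < k := by
      rcases hk0.eq_or_lt with h' | h'
      · rw [← h'] at h; linarith
      · exact h'
    have hp : 0 < (k * r - ω r) / (2 * k) := div_pos (by linarith) (by linarith)
    have h1 := hk _ hp
    have h2 := hn _ hp
    have h3 : k * ((k * r - ω r) / (2 * k) - r) = (k * r - ω r) / 2 - k * r := by
      field_simp
    linarith
  refine ⟨ω r * k / r, by positivity, ?_, ?_⟩
  · have : ω r * k / r * r ^ 2 = ω r * (k * r) := by field_simp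
    rw [this, sq]
    exact mul_le_mul_of_nonneg_left hkr hwr
  · intro t ht
    have h1 : ω t ^ 2 ≤ (ω r + k * (t - r)) ^ 2 :=
      pow_le_pow_left₀ (hn t ht) (hk t ht) 2
    have h2 : ω r ^ 2 + ω r * k / r * (t ^ 2 - r ^ 2) - (ω r + k * (t - r)) ^ 2
        = k * (t - r) ^ 2 / r * (ω r - k * r) := by
      field_simp
      ring
    have h3 : 0 ≤ k * (t - r) ^ 2 / r * (ω r - k * r) :=
      mul_nonneg (by positivity) (by linarith)
    linarith

/-- The kernel `min (d i) (d j) * ⟪v i, v j⟫` is positive semidefinite. -/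
lemma bl_min_kernel {ι H : Type*} [NormedAddCommGroup H] [InnerProductSpace ℝ H]
    (d : ι → ℝ) (v : ι → H) (s : Finset ι) :
    ∀ c, 0 ≤ c → (∀ i ∈ s, c ≤ d i) →
      c * ‖∑ i ∈ s, v i‖ ^ 2 ≤ ∑ i ∈ s, ∑ j ∈ s, min (d i) (d j) * inner ℝ (v i) (v j) := by
  classical
  induction s using Finset.induction_on_min_value d with
  | empty => simp
  | insert a s ha hmin ih =>
    intro c hc hcd
    have hca : c ≤ d a := hcd a (by simp)
    have h1 := ih (d a) (hc.trans hca) hmin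
    have e1 : ∑ j ∈ s, min (d a) (d j) * inner ℝ (v a) (v j)
        = d a * inner ℝ (v a) (∑ j ∈ s, v j) := by
      rw [inner_sum, Finset.mul_sum]
      exact Finset.sum_congr rfl fun j hj => by rw [min_eq_left (hmin j hj)]
    have e2 : ∑ j ∈ s, min (d j) (d a) * inner ℝ (v j) (v a)
        = d a * inner ℝ (v a) (∑ j ∈ s, v j) := by
      rw [← e1]
      exact Finset.sum_congr rfl fun j hj => by rw [min_comm, real_inner_comm]
    simp only [Finset.sum_insert ha, Finset.sum_add_distrib]
    rw [e1, e2, min_self, real_inner_self_eq_norm_sq]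
    have h2 := norm_add_sq_real (v a) (∑ j ∈ s, v j)
    have h3 := mul_le_mul_of_nonneg_right hca (sq_nonneg ‖v a + ∑ j ∈ s, v j‖)
    rw [h2] at h3 ⊢
    linarith

/-- `ω` extended by `0` to the nonpositive numbers. -/
noncomputable def blExt (ω : ℝ → ℝ) (t : ℝ) : ℝ := if 0 < t then ω t else 0

lemma blExt_nonneg (ω : ℝ → ℝ) (hn : ∀ t > (0 : ℝ), 0 ≤ ω t) (t : ℝ) : 0 ≤ blExt ω t := by
  unfold blExt
  split_ifs with h
  · exact hn t h
  · exact le_rfl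

lemma bl_kernel {ι H : Type*} [Fintype ι] [NormedAddCommGroup H] [InnerProductSpace ℝ H]
    (ω : ℝ → ℝ) (hn : ∀ t > (0 : ℝ), 0 ≤ ω t)
    (hc : ConcaveOn ℝ (Set.Ioi 0) ω) (v : ι → H) (hv : ∀ i, v i ≠ 0) (μ : ι → ℝ)
    (hμ : ∀ i, 0 ≤ μ i) (hμ1 : ∑ i, μ i = 1) :
    ∑ i, ∑ j, μ i * μ j * blExt ω ‖v i - v j‖ ^ 2 ≤ 2 * ∑ i, μ i * blExt ω ‖v i‖ ^ 2 := by
  have hD : ∀ r : ℝ, 0 < r → ∃ D : ℝ, 0 ≤ D ∧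
      ∀ t ≥ 0, blExt ω t ^ 2 ≤ blExt ω r ^ 2 + D * (t ^ 2 - r ^ 2) := by
    intro r hr
    obtain ⟨D, h0, h1, h2⟩ := bl_supergrad ω hn hc r hr
    refine ⟨D, h0, fun t ht => ?_⟩
    rcases ht.eq_or_lt with h | h
    · subst h
      simp only [blExt, hr, if_true, lt_irrefl, if_false]
      linarith
    · have h' : 0 < t := h
      simp only [blExt, hr, h', if_true]
      exact h2 t h
  choose! D hD0 hD1 using hD
  have hvp : ∀ i, 0 < ‖v i‖ := fun i => norm_pos_iff.2 (hv i)
  have hpair0 : ∀ i j, ‖v i‖ ≤ ‖v j‖ → blExt ω ‖v i - v j‖ ^ 2 ≤ blExt ω ‖v i‖ ^ 2 +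
      blExt ω ‖v j‖ ^ 2 - 2 * (min (D ‖v i‖) (D ‖v j‖) * inner ℝ (v i) (v j)) := by
    intro i j hij
    have hanti : D ‖v j‖ ≤ D ‖v i‖ := by
      rcases hij.eq_or_lt with h | h
      · rw [h]
      · have a1 := hD1 _ (hvp i) _ (hvp j).le
        have a2 := hD1 _ (hvp j) _ (hvp i).le
        have a3 : 0 < ‖v j‖ ^ 2 - ‖v i‖ ^ 2 := by
          have := hvp i
          nlinarith
        by_contra hcon
        push Not at hcon
        nlinarith
    rw [min_eq_right hanti]
    have b1 := hD1 _ (hvp j) ‖v i - v j‖ (norm_nonneg _)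
    have b2 := hD1 _ (hvp i) 0 le_rfl
    have b3 : blExt ω 0 = 0 := by simp [blExt]
    rw [b3] at b2
    rw [norm_sub_sq_real] at b1
    have b4 := mul_le_mul_of_nonneg_right hanti (sq_nonneg ‖v i‖)
    linarith
  have hpair : ∀ i j, blExt ω ‖v i - v j‖ ^ 2 ≤ blExt ω ‖v i‖ ^ 2 +
      blExt ω ‖v j‖ ^ 2 - 2 * (min (D ‖v i‖) (D ‖v j‖) * inner ℝ (v i) (v j)) := by
    intro i j
    rcases le_total ‖v i‖ ‖v j‖ with h | h
    · exact hpair0 i j h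
    · have := hpair0 j i h
      rw [norm_sub_rev, min_comm, real_inner_comm] at this
      linarith
  have hps := bl_min_kernel (fun i => D ‖v i‖) (fun i => μ i • v i) Finset.univ 0 le_rfl
    (fun i _ => hD0 _ (hvp i))
  rw [zero_mul] at hps
  calc ∑ i, ∑ j, μ i * μ j * blExt ω ‖v i - v j‖ ^ 2
      ≤ ∑ i, ∑ j, (μ j * (μ i * blExt ω ‖v i‖ ^ 2) + μ i * (μ j * blExt ω ‖v j‖ ^ 2)
          - 2 * (min (D ‖v i‖) (D ‖v j‖) * inner ℝ (μ i • v i) (μ j • v j))) := by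
        refine Finset.sum_le_sum fun i _ => Finset.sum_le_sum fun j _ => ?_
        have := mul_le_mul_of_nonneg_left (hpair i j) (mul_nonneg (hμ i) (hμ j))
        rw [real_inner_smul_left, real_inner_smul_right]
        linarith
    _ = 2 * ∑ i, μ i * blExt ω ‖v i‖ ^ 2 -
        2 * ∑ i, ∑ j, min (D ‖v i‖) (D ‖v j‖) * inner ℝ (μ i • v i) (μ j • v j) := by
        simp only [Finset.sum_sub_distrib, Finset.sum_add_distrib, ← Finset.mul_sum,
          ← Finset.sum_mul, hμ1]
        ring
    _ ≤ _ := by linarith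

/-- Variance identity. -/
lemma bl_variance {ι H : Type*} [Fintype ι] [NormedAddCommGroup H] [InnerProductSpace ℝ H]
    (y : ι → H) (μ : ι → ℝ) (hμ1 : ∑ i, μ i = 1) :
    2 * ∑ i, μ i * ‖(∑ j, μ j • y j) - y i‖ ^ 2 = ∑ i, ∑ j, μ i * μ j * ‖y i - y j‖ ^ 2 := by
  set m := ∑ j, μ j • y j with hm
  have h0 : ∑ j, μ j • (m - y j) = 0 := by
    simp only [smul_sub, Finset.sum_sub_distrib, ← Finset.sum_smul, hμ1, one_smul, ← hm, sub_self]
  have hin : ∑ i, ∑ j, μ i * μ j * inner ℝ (m - y i) (m - y j) = 0 := by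
    have : inner ℝ (∑ i, μ i • (m - y i)) (∑ j, μ j • (m - y j)) = 0 := by rw [h0, inner_zero_left]
    rw [← this, sum_inner]
    refine Finset.sum_congr rfl fun i _ => ?_
    rw [inner_sum]
    refine Finset.sum_congr rfl fun j _ => ?_
    rw [real_inner_smul_left, real_inner_smul_right]
    ring
  have hexp : ∀ i j, μ i * μ j * ‖y i - y j‖ ^ 2 = μ j * (μ i * ‖m - y i‖ ^ 2) +
      μ i * (μ j * ‖m - y j‖ ^ 2) - 2 * (μ i * μ j * inner ℝ (m - y i) (m - y j)) := by
    intro i j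
    have : y i - y j = (m - y j) - (m - y i) := by abel
    rw [this, norm_sub_sq_real, real_inner_comm]
    ring
  simp only [hexp, Finset.sum_sub_distrib, Finset.sum_add_distrib, ← Finset.mul_sum, hin,
    ← Finset.sum_mul, hμ1]
  ring

lemma bl_finite {ι H1 H2 : Type*} [Fintype ι] [NormedAddCommGroup H1] [InnerProductSpace ℝ H1]
    [NormedAddCommGroup H2] [InnerProductSpace ℝ H2]
    (ω : ℝ → ℝ) (hn : ∀ t > (0 : ℝ), 0 ≤ ω t)
    (hc : ConcaveOn ℝ (Set.Ioi 0) ω) (v : ι → H1) (hv : ∀ i, v i ≠ 0) (y : ι → H2)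
    (hy : ∀ i j, ‖y i - y j‖ ≤ blExt ω ‖v i - v j‖) :
    ∃ z : H2, ∀ i, ‖z - y i‖ ≤ blExt ω ‖v i‖ := by
  classical
  rcases isEmpty_or_nonempty ι with hι | hι
  · exact ⟨0, fun i => isEmptyElim i⟩
  let f : H2 → (ι → ℝ) → ℝ := fun z μ => ∑ i, μ i * (‖z - y i‖ ^ 2 - blExt ω ‖v i‖ ^ 2)
  have hlin : ∀ z, IsLinearMap ℝ (f z) := by
    intro z
    refine ⟨fun a b => ?_, fun c a => ?_⟩
    · simp only [f, Pi.add_apply, add_mul, Finset.sum_add_distrib]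
    · simp only [f, Pi.smul_apply, smul_eq_mul, Finset.mul_sum, mul_assoc]
  obtain ⟨a, ha, b, hb, hab⟩ := Sion.exists_isSaddlePointOn
    (X := convexHull ℝ (Set.range y)) (Y := stdSimplex ℝ ι) (f := f)
    (Set.range_nonempty y).convexHull (convex_convexHull ℝ _)
    ((Set.finite_range y).isCompact_convexHull ℝ)
    (fun μ _ => by
      refine Continuous.lowerSemicontinuous (f := fun z => f z μ) ?_ |>.lowerSemicontinuousOn _
      simp only [f]
      fun_prop)
    (fun μ hμ => by
      apply ConvexOn.quasiconvexOn
      refine ConvexOn.subset ?_ (Set.subset_univ _) (convex_convexHull ℝ _)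
      refine ⟨convex_univ, fun p _ q _ s t hs ht hst => ?_⟩
      simp only [f, smul_eq_mul, Finset.mul_sum, ← Finset.sum_add_distrib]
      refine Finset.sum_le_sum fun i _ => ?_
      have hcv : ‖s • p + t • q - y i‖ ^ 2 ≤ s * ‖p - y i‖ ^ 2 + t * ‖q - y i‖ ^ 2 := by
        have e : s • p + t • q - y i = s • (p - y i) + t • (q - y i) := by
          have : y i = (s + t) • y i := by rw [hst, one_smul]
          nth_rewrite 1 [this]
          module
        have n1 : ‖s • p + t • q - y i‖ ≤ s * ‖p - y i‖ + t * ‖q - y i‖ := by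
          rw [e]
          refine (norm_add_le _ _).trans ?_
          rw [norm_smul, norm_smul, Real.norm_of_nonneg hs, Real.norm_of_nonneg ht]
        have n2 := pow_le_pow_left₀ (norm_nonneg _) n1 2
        have ht' : t = 1 - s := by linarith
        have n3 : 0 ≤ s * t * (‖p - y i‖ - ‖q - y i‖) ^ 2 := by positivity
        subst ht'
        nlinarith
      have := mul_le_mul_of_nonneg_left hcv (hμ.1 i)
      have e2 : μ i * blExt ω ‖v i‖ ^ 2 = (s + t) * (μ i * blExt ω ‖v i‖ ^ 2) := by
        rw [hst, one_mul]
      linarith)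
    (convex_stdSimplex ℝ ι) ⟨_, single_mem_stdSimplex ℝ (Classical.arbitrary ι)⟩
    (isCompact_stdSimplex ℝ ι)
    (fun z _ => by
      refine Continuous.upperSemicontinuous (f := f z) ?_ |>.upperSemicontinuousOn _
      simp only [f]
      fun_prop)
    (fun z _ => by
      apply ConcaveOn.quasiconcaveOn
      exact (hlin z).mk' (f z) |>.concaveOn (convex_stdSimplex ℝ ι))
  refine ⟨a, fun i => ?_⟩
  have h1 := hab (∑ j, b j • y j)
    ((convex_convexHull ℝ _).sum_mem (fun j _ => hb.1 j) hb.2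
      (fun j _ => subset_convexHull ℝ _ ⟨j, rfl⟩)) (Pi.single i 1) (single_mem_stdSimplex ℝ i)
  have h2 : f a (Pi.single i 1) = ‖a - y i‖ ^ 2 - blExt ω ‖v i‖ ^ 2 := by
    simp [f, Pi.single_apply]
  have h3 := bl_variance y b hb.2
  have h4 := bl_kernel ω hn hc v hv b hb.1 hb.2
  have h5 : ∑ i, ∑ j, b i * b j * ‖y i - y j‖ ^ 2
      ≤ ∑ i, ∑ j, b i * b j * blExt ω ‖v i - v j‖ ^ 2 := by
    refine Finset.sum_le_sum fun i _ => Finset.sum_le_sum fun j _ => ?_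
    exact mul_le_mul_of_nonneg_left (pow_le_pow_left₀ (norm_nonneg _) (hy i j) 2)
      (mul_nonneg (hb.1 i) (hb.1 j))
  have h6 : f (∑ j, b j • y j) b ≤ 0 := by
    simp only [f, mul_sub, Finset.sum_sub_distrib]
    linarith
  refine le_of_sq_le_sq ?_ (blExt_nonneg ω hn _)
  linarith

lemma bl_onepoint {H1 H2 : Type*} [NormedAddCommGroup H1] [InnerProductSpace ℝ H1]
    [NormedAddCommGroup H2] [InnerProductSpace ℝ H2] [CompleteSpace H2]
    (ω : ℝ → ℝ) (hn : ∀ t > (0 : ℝ), 0 ≤ ω t)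
    (hc : ConcaveOn ℝ (Set.Ioi 0) ω) {ι : Type*} (v : ι → H1) (hv : ∀ i, v i ≠ 0) (y : ι → H2)
    (hy : ∀ i j, ‖y i - y j‖ ≤ blExt ω ‖v i - v j‖) :
    ∃ z : H2, ∀ i, ‖z - y i‖ ≤ blExt ω ‖v i‖ := by
  classical
  rcases isEmpty_or_nonempty ι with hι | ⟨⟨i0⟩⟩
  · exact ⟨0, fun i => isEmptyElim i⟩
  let T := InnerProductSpace.toDual ℝ H2
  let B : ι → Set (WeakDual ℝ H2) := fun i =>
    WeakDual.toStrongDual ⁻¹' Metric.closedBall (T (y i)) (blExt ω ‖v i‖)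
  have hne : (B i0 ∩ ⋂ i, B i).Nonempty := by
    refine IsCompact.inter_iInter_nonempty (WeakDual.isCompact_closedBall _ _) B
      (fun i => WeakDual.isClosed_closedBall _ _) fun s => ?_
    obtain ⟨z, hz⟩ := bl_finite ω hn hc (ι := ↥(insert i0 s)) (fun i => v i) (fun i => hv i)
      (fun i => y i) (fun i j => hy i j)
    have key : ∀ i ∈ insert i0 s, StrongDual.toWeakDual (T z) ∈ B i := by
      intro i hi
      have := hz ⟨i, hi⟩
      change dist (T z) (T (y i)) ≤ _
      rw [LinearIsometryEquiv.dist_map, dist_eq_norm]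
      exact this
    refine ⟨StrongDual.toWeakDual (T z), key i0 (by simp), ?_⟩
    simp only [Set.mem_iInter]
    exact fun i hi => key i (Finset.mem_insert_of_mem hi)
  obtain ⟨g, -, hg⟩ := hne
  rw [Set.mem_iInter] at hg
  refine ⟨T.symm (WeakDual.toStrongDual g), fun i => ?_⟩
  have h1 : dist (WeakDual.toStrongDual g) (T (y i)) ≤ blExt ω ‖v i‖ := hg i
  rw [← dist_eq_norm, ← LinearIsometryEquiv.dist_map T, LinearIsometryEquiv.apply_symm_apply]
  exact h1

/-- **Benyamini–Lindenstrauss extension.** A uniformly continuous map from a subset of a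
real Hilbert space into another real Hilbert space, with concave modulus of continuity `ω`
vanishing at `0+`, extends to the whole space with the same modulus of continuity. -/
theorem benyamini_lindenstrauss_extension
    {H1 H2 : Type*}
    [NormedAddCommGroup H1] [InnerProductSpace ℝ H1] [CompleteSpace H1]
    [NormedAddCommGroup H2] [InnerProductSpace ℝ H2] [CompleteSpace H2]
    (U : Set H1) (ω : ℝ → ℝ)
    (hω_nonneg : ∀ t > (0 : ℝ), 0 ≤ ω t)
    (hω_concave : ConcaveOn ℝ (Set.Ioi 0) ω)
    (hω_lim : Tendsto ω (nhdsWithin 0 (Set.Ioi 0)) (nhds 0))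
    (G : U → H2)
    (hG : ∀ x y : U, (x : H1) ≠ (y : H1) → ‖G x - G y‖ ≤ ω ‖(x : H1) - (y : H1)‖) :
    ∃ Gext : H1 → H2,
      (∀ x : U, Gext x = G x) ∧
      (∀ x y : H1, x ≠ y → ‖Gext x - Gext y‖ ≤ ω ‖x - y‖) := by
  have h00 : blExt ω 0 = 0 := by simp [blExt]
  let P : Set (Set (H1 × H2)) :=
    {S | ∀ p ∈ S, ∀ q ∈ S, ‖p.2 - q.2‖ ≤ blExt ω ‖p.1 - q.1‖}
  obtain ⟨S, hS0, hS⟩ := zorn_subset_nonempty P (by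
    intro c hcP hchain _
    refine ⟨⋃₀ c, ?_, fun s hs => Set.subset_sUnion_of_mem hs⟩
    rintro p ⟨s, hs, hps⟩ q ⟨t, ht, hqt⟩
    rcases hchain.total hs ht with h | h
    · exact hcP ht p (h hps) q hqt
    · exact hcP hs p hps q (h hqt)) (Set.range fun u : U => ((u : H1), G u)) (by
    rintro _ ⟨x, rfl⟩ _ ⟨y, rfl⟩
    by_cases hxy : (x : H1) = y
    · have : x = y := Subtype.ext hxy
      subst this
      simp [h00]
    · have hp : 0 < ‖(x : H1) - y‖ := norm_pos_iff.2 (sub_ne_zero.2 hxy)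
      simp only [blExt, hp, if_true]
      exact hG x y hxy)
  have hSP := hS.prop
  have hex : ∀ x : H1, ∃ z : H2, (x, z) ∈ S := by
    intro x
    by_contra hcon
    push Not at hcon
    obtain ⟨z, hz⟩ := bl_onepoint ω hω_nonneg hω_concave (ι := S) (fun p => p.1.1 - x)
      (fun p h => hcon p.1.2 (by
        rw [← sub_eq_zero.1 h]
        exact p.2))
      (fun p => p.1.2) (fun p q => by
        rw [sub_sub_sub_cancel_right]
        exact hSP p.1 p.2 q.1 q.2)
    have hins : insert (x, z) S ∈ P := by
      rintro p (rfl | hp) q (rfl | hq)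
      · simp [h00]
      · have := hz ⟨q, hq⟩
        rwa [norm_sub_rev q.1] at this
      · have := hz ⟨p, hp⟩
        rwa [norm_sub_rev z] at this
      · exact hSP p hp q hq
    exact hcon z (hS.le_of_ge hins (Set.subset_insert _ _) (Set.mem_insert _ _))
  choose F hF using hex
  refine ⟨F, fun x => ?_, fun x y hxy => ?_⟩
  · have := hSP _ (hF x) _ (hS0 ⟨x, rfl⟩)
    simp only [sub_self, norm_zero, h00] at this
    exact sub_eq_zero.1 (norm_le_zero_iff.1 this)
  · have := hSP _ (hF x) _ (hF y)
    have hp : 0 < ‖x - y‖ := norm_pos_iff.2 (sub_ne_zero.2 hxy)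
    simpa only [blExt, hp, if_true] using this
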